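/- arXiv:2407.13861 — 14 statements merged into one kernel-verified Lean document; each statement's English description precedes it below -/
import Mathlib

section
/- Let H be a complex Hilbert space and let T = A + iB be a bounded linear operator on H, where A and B are self-adjoint (the Cartesian decomposition, A = Re T = (T + T*)/2 and B = Im T = (T − T*)/(2i)). If T³ and T² are self-adjoint and A is positive (or A is negative, i.e., −A is positive), then T is self-adjoint. -/
open ContinuousLinearMap

/-- A nonnegative operator is orthogonal to every operator with which it anticommutes. -/
theorem mul_eq_zero_of_nonneg_of_anticommute
    {H : Type*} [NormedAddCommGroup H] [InnerProductSpace ℂ H] [CompleteSpace H]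
    {A B : H →L[ℂ] H} (hA : 0 ≤ A) (hAB : A * B = -(B * A)) : A * B = 0 := by
  have hsq : Commute (A * A) B := by
    rw [commute_iff_eq, mul_assoc, hAB, mul_neg, ← mul_assoc, hAB, neg_mul, neg_neg, mul_assoc]
  have hcomm : A * B = B * A := by
    have h : Commute (CFC.sqrt (A * A)) B := hsq.cfcₙ_nnreal NNReal.sqrt
    rwa [CFC.sqrt_mul_self A] at h
  have := IsAddTorsionFree.of_isTorsionFree ℂ (H →L[ℂ] H)
  exact self_eq_neg.mp (hAB.trans (congrArg Neg.neg hcomm.symm))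

/-- A self-adjoint operator with vanishing cube vanishes. -/
theorem IsSelfAdjoint.eq_zero_of_pow_three_eq_zero
    {E : Type*} [NonUnitalNormedRing E] [StarRing E] [CStarRing E] {b : E}
    (hb : IsSelfAdjoint b) (h : b * b * b = 0) : b = 0 := by
  have h2 : b * b = 0 := by
    rw [← CStarRing.star_mul_self_eq_zero_iff, star_mul, hb.star_eq, ← mul_assoc, h, zero_mul]
  rwa [← CStarRing.star_mul_self_eq_zero_iff, hb.star_eq]

theorem selfAdjoint_of_cube_sq_selfAdjoint_re_pos
    {H : Type*} [NormedAddCommGroup H] [InnerProductSpace ℂ H] [CompleteSpace H]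
    (T A B : H →L[ℂ] H) (hA : IsSelfAdjoint A) (hB : IsSelfAdjoint B)
    (hT : T = A + Complex.I • B)
    (h3 : IsSelfAdjoint (T ^ 3)) (h2 : IsSelfAdjoint (T ^ 2))
    (hpos : A.IsPositive ∨ (-A).IsPositive) :
    IsSelfAdjoint T := by
  subst hT
  have hstar : star (A + Complex.I • B) = A - Complex.I • B := by
    simp [hA.star_eq, hB.star_eq, sub_eq_add_neg]
  have hanti : A * B = -(B * A) := by
    have h := h2.star_eq
    rw [star_pow, hstar] at h
    simp only [pow_two, mul_add, add_mul, mul_sub, sub_mul, smul_mul_assoc, mul_smul_comm] at h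
    have h' : (2 * Complex.I) • (A * B) = (2 * Complex.I) • -(B * A) := by
      linear_combination (norm := module) (-1 : ℂ) • h
    exact smul_right_injective _ (by simp) h'
  have hAB : A * B = 0 := by
    rcases hpos with hp | hp
    · exact mul_eq_zero_of_nonneg_of_anticommute ((nonneg_iff_isPositive A).mpr hp) hanti
    · have h := mul_eq_zero_of_nonneg_of_anticommute (B := B)
        ((nonneg_iff_isPositive (-A)).mpr hp) (by rw [neg_mul, mul_neg, hanti])
      rwa [neg_mul, neg_eq_zero] at h
  have hBA : B * A = 0 := by rwa [hAB, zero_eq_neg] at hanti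
  have hB3 : B * B * B = 0 := by
    have h := h3.star_eq
    rw [star_pow, hstar] at h
    simp only [pow_succ, pow_zero, one_mul, mul_add, add_mul, mul_sub, sub_mul, smul_mul_assoc,
      mul_smul_comm, hAB, hBA, mul_assoc A A B, mul_assoc B B A, mul_zero, zero_mul] at h
    have h' : (2 * Complex.I ^ 3) • (B * B * B) = 0 := by
      linear_combination (norm := module) (-1 : ℂ) • h
    exact (smul_eq_zero.mp h').resolve_left (by simp)
  rw [hB.eq_zero_of_pow_three_eq_zero hB3, smul_zero, add_zero]
  exact hA
end

section
/- Let H be a complex Hilbert space and let T = A + iB be a bounded linear operator on H, where A and B are self-adjoint (the Cartesian decomposition, A = Re T = (T + T*)/2 and B = Im T = (T − T*)/(2i)). If T³ and T² are self-adjoint and B is positive (or B is negative, i.e., −B is positive), then T is self-adjoint. -/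
open ContinuousLinearMap

/-- An operator that anticommutes with a positive operator annihilates it. -/
theorem mul_eq_zero_of_anticommute_isPositive
    {H : Type*} [NormedAddCommGroup H] [InnerProductSpace ℂ H] [CompleteSpace H]
    {A B : H →L[ℂ] H} (hB : B.IsPositive) (h : A * B = -(B * A)) : A * B = 0 := by
  have hB0 : 0 ≤ B := (nonneg_iff_isPositive B).2 hB
  have hsq : Commute (B * B) A := by
    change B * B * A = A * (B * B)
    calc B * B * A = -(B * -(B * A)) := by noncomm_ring
      _ = -(B * (A * B)) := by rw [h]
      _ = -(B * A) * B := by noncomm_ring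
      _ = A * (B * B) := by rw [← h, mul_assoc]
  have hcomm : Commute B A := by
    have := hsq.cfcₙ_nnreal NNReal.sqrt
    rwa [← CFC.sqrt, CFC.sqrt_mul_self B hB0] at this
  rw [hcomm.eq] at h
  have h2 : (2 : ℂ) • (A * B) = 0 := by rw [two_smul]; exact eq_neg_iff_add_eq_zero.mp h
  exact (smul_eq_zero.1 h2).resolve_left two_ne_zero

theorem IsSelfAdjoint.eq_zero_of_mul_self_mul_self_eq_zero
    {R : Type*} [NonUnitalNormedRing R] [StarRing R] [CStarRing R] {b : R}
    (hb : IsSelfAdjoint b) (h : b * b * b = 0) : b = 0 := by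
  have h2 : b * b = 0 := by
    rw [← CStarRing.star_mul_self_eq_zero_iff, star_mul, hb.star_eq, ← mul_assoc, h, zero_mul]
  rwa [← CStarRing.star_mul_self_eq_zero_iff, hb.star_eq]

theorem selfAdjoint_of_cube_sq_selfAdjoint_im_pos
    {H : Type*} [NormedAddCommGroup H] [InnerProductSpace ℂ H] [CompleteSpace H]
    (T A B : H →L[ℂ] H) (hA : IsSelfAdjoint A) (hB : IsSelfAdjoint B)
    (hT : T = A + Complex.I • B)
    (h3 : IsSelfAdjoint (T ^ 3)) (h2 : IsSelfAdjoint (T ^ 2))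
    (hpos : B.IsPositive ∨ (-B).IsPositive) :
    IsSelfAdjoint T := by
  have hstar : star T = A - Complex.I • B := by
    rw [hT, star_add, star_smul, hA.star_eq, hB.star_eq, Complex.star_def, Complex.conj_I,
      neg_smul, sub_eq_add_neg]
  have hanti : A * B = -(B * A) := by
    have h := h2.star_eq
    rw [star_pow, hstar, hT] at h
    have h' : (2 * Complex.I) • (A * B + B * A) = 0 := by
      rw [← sub_eq_zero.2 h.symm]
      simp only [pow_two, add_mul, mul_add, sub_mul, mul_sub, smul_mul_assoc, mul_smul_comm]
      module
    exact eq_neg_of_add_eq_zero_left ((smul_eq_zero.1 h').resolve_left (by simp))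
  have hAB : A * B = 0 := by
    rcases hpos with hp | hn
    · exact mul_eq_zero_of_anticommute_isPositive hp hanti
    · have := mul_eq_zero_of_anticommute_isPositive (A := A) hn (by simp [hanti])
      simpa using this
  have hBA : B * A = 0 := by rwa [hAB, zero_eq_neg] at hanti
  have hB0 : B = 0 := by
    refine hB.eq_zero_of_mul_self_mul_self_eq_zero ?_
    have h := h3.star_eq
    rw [star_pow, hstar, hT] at h
    have h' : (2 * Complex.I ^ 3) • (B * B * B) = 0 := by
      rw [← sub_eq_zero.2 h.symm]
      simp only [pow_succ, pow_zero, one_mul, add_mul, mul_add, sub_mul, mul_sub, smul_mul_assoc,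
        mul_smul_comm, mul_assoc, hAB, hBA, mul_zero, zero_mul]
      module
    exact (smul_eq_zero.1 h').resolve_left (by simp)
  rw [hT, hB0, smul_zero, add_zero]
  exact hA
end

section
/- Let H be a complex Hilbert space and let T = A + iB be a bounded linear operator on H, where A and B are self-adjoint (the Cartesian decomposition). Assume T³ is self-adjoint. If A ≥ 0 or A ≤ 0 or B ≥ 0 or B ≤ 0, then T² is self-adjoint if and only if T is self-adjoint. -/
open ContinuousLinearMap

section StarRing

variable {R : Type*} [NormedRing R] [StarRing R] [CStarRing R]

theorem IsSelfAdjoint.eq_zero_of_pow_three_eq_zero_s3 {b : R} (hb : IsSelfAdjoint b)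
    (h : b * b * b = 0) : b = 0 := by
  have hsq : b * b = 0 := by
    rw [← CStarRing.star_mul_self_eq_zero_iff, star_mul, hb.star_eq, ← mul_assoc, h, zero_mul]
  rwa [← CStarRing.star_mul_self_eq_zero_iff, hb.star_eq]

variable [PartialOrder R] [StarOrderedRing R]

theorem eq_zero_of_anticommute_of_nonneg_right {a b : R} (ha : IsSelfAdjoint a)
    (hb : 0 ≤ b) (hab : a * b = -(b * a)) (hcube : a * a * b = b * b * b) : b = 0 := by
  have hbs : IsSelfAdjoint b := .of_nonneg hb
  have hconj : 0 ≤ a * b * a := by simpa only [ha.star_eq] using star_left_conjugate_nonneg hb a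
  have hbbb : 0 ≤ b * b * b := by simpa only [hbs.star_eq] using star_left_conjugate_nonneg hb b
  have hneg : a * b * a = -(b * b * b) := by
    rw [← hcube, mul_assoc a b a, ← neg_eq_iff_eq_neg.mpr hab, mul_neg, mul_assoc]
  rw [hneg] at hconj
  exact hbs.eq_zero_of_pow_three_eq_zero_s3 (le_antisymm (neg_nonneg.mp hconj) hbbb)

theorem eq_zero_of_anticommute_of_nonneg_left {a b : R} (ha : 0 ≤ a)
    (hb : IsSelfAdjoint b) (hab : a * b = -(b * a)) (hcube : a * a * b = b * b * b) :
    b = 0 := by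
  have has : IsSelfAdjoint a := .of_nonneg ha
  have hba : b * a = -(a * b) := by rw [hab, neg_neg]
  have hcomm : b * b * a = a * (b * b) := by
    rw [mul_assoc, hba, mul_neg, ← mul_assoc, hba, neg_mul, neg_neg, mul_assoc]
  have hpos : 0 ≤ b * b * a * (b * b) := by
    simpa only [star_mul, hb.star_eq] using star_left_conjugate_nonneg ha (b * b)
  have hconj : 0 ≤ b * a * a * (a * b) := by
    simpa only [star_mul, hb.star_eq, has.star_eq] using star_left_conjugate_nonneg ha (a * b)
  have hneg : b * a * a * (a * b) = -(b * b * a * (b * b)) := by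
    calc b * a * a * (a * b) = b * a * (a * a * b) := by simp only [mul_assoc]
      _ = -(a * (b * b) * (b * b)) := by rw [hcube, hba]; simp only [neg_mul, mul_assoc]
      _ = -(b * b * a * (b * b)) := by rw [hcomm]
  rw [hneg] at hconj
  have hzero : a * (b * b) * (b * b) = 0 := by
    rw [← hcomm]
    exact le_antisymm (neg_nonneg.mp hconj) hpos
  have hsix : star (b * b * b) * (b * b * b) = 0 := by
    calc star (b * b * b) * (b * b * b) = b * b * b * (b * b * b) := by
          simp only [star_mul, hb.star_eq, mul_assoc]
      _ = a * (a * (b * b) * (b * b)) := by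
          rw [← hcube]
          nth_rewrite 2 [hcube]
          simp only [mul_assoc]
      _ = 0 := by rw [hzero, mul_zero]
  exact hb.eq_zero_of_pow_three_eq_zero_s3 (CStarRing.star_mul_self_eq_zero_iff _ |>.mp hsix)

end StarRing

theorem sq_selfAdjoint_iff_selfAdjoint_of_cube_selfAdjoint
    {H : Type*} [NormedAddCommGroup H] [InnerProductSpace ℂ H] [CompleteSpace H]
    (T A B : H →L[ℂ] H) (hA : IsSelfAdjoint A) (hB : IsSelfAdjoint B)
    (hT : T = A + Complex.I • B)
    (h3 : IsSelfAdjoint (T ^ 3))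
    (hpos : A.IsPositive ∨ (-A).IsPositive ∨ B.IsPositive ∨ (-B).IsPositive) :
    IsSelfAdjoint (T ^ 2) ↔ IsSelfAdjoint T := by
  refine ⟨fun h2 => ?_, fun h => h.pow 2⟩
  have hstar : star T = A - Complex.I • B := by
    rw [hT, star_add, star_smul, hA.star_eq, hB.star_eq, sub_eq_add_neg]
    simp
  have hsub : T - star T = (2 * Complex.I) • B := by
    rw [hstar, hT]
    module
  have h2I : (2 * Complex.I) ≠ 0 := by simp
  have hsq : T ^ 2 = A * A - B * B + Complex.I • (A * B + B * A) := by
    rw [hT, sq]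
    simp only [add_mul, mul_add, smul_add, smul_mul_assoc, mul_smul_comm, smul_smul, Complex.I_mul_I]
    module
  have hsq_star : star (T ^ 2) = A * A - B * B - Complex.I • (A * B + B * A) := by
    rw [star_pow, hstar, sq]
    simp only [sub_mul, mul_sub, smul_sub, smul_mul_assoc, mul_smul_comm, smul_smul, Complex.I_mul_I]
    module
  have hanti : A * B + B * A = 0 := by
    have h : (2 * Complex.I) • (A * B + B * A) = T ^ 2 - star (T ^ 2) := by
      rw [hsq_star, hsq]
      module
    rw [h2.star_eq, sub_self] at h
    exact (smul_eq_zero.mp h).resolve_left h2I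
  have hab : A * B = -(B * A) := eq_neg_of_add_eq_zero_left hanti
  have hcube : A * A * B = B * B * B := by
    have h : T ^ 2 * (T - star T) = 0 := by
      have h' : star (T ^ 3) = T ^ 2 * star T := by
        rw [pow_succ' T 2, star_mul, h2.star_eq]
      rw [mul_sub, ← h', h3.star_eq, ← pow_succ, sub_self]
    rw [hsub, mul_smul_comm] at h
    have h0 := (smul_eq_zero.mp h).resolve_left h2I
    rwa [hsq, hanti, smul_zero, add_zero, sub_mul, sub_eq_zero] at h0
  have hB0 : B = 0 := by
    simp only [← nonneg_iff_isPositive] at hpos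
    rcases hpos with h | h | h | h
    · exact eq_zero_of_anticommute_of_nonneg_left h hB hab hcube
    · exact eq_zero_of_anticommute_of_nonneg_left h hB (by simp [hab]) (by simpa using hcube)
    · exact eq_zero_of_anticommute_of_nonneg_right hA h hab hcube
    · exact neg_eq_zero.mp <|
        eq_zero_of_anticommute_of_nonneg_right hA h (by simp [hab]) (by simpa using hcube)
  rwa [hT, hB0, smul_zero, add_zero]
end

section
/- Let H be a complex Hilbert space and let T = A + iB be a bounded linear operator on H, where A and B are self-adjoint (the Cartesian decomposition). If T³ and T² are positive and B ≥ 0 (or B ≤ 0), then T is positive. -/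
open ContinuousLinearMap

section CStarAlgebra

variable {R : Type*} [CStarAlgebra R] [PartialOrder R] [StarOrderedRing R]

/-- A nonnegative element that anticommutes with `a` is annihilated by `a`. -/
theorem mul_eq_zero_of_anticommute_of_nonneg {a b : R} (hb : 0 ≤ b)
    (h : a * b + b * a = 0) : a * b = 0 := by
  have hab : a * b = -(b * a) := eq_neg_of_add_eq_zero_left h
  have hsq : Commute (b * b) a := by
    change b * b * a = a * (b * b)
    rw [← mul_assoc, hab, neg_mul, mul_assoc b a b, hab, mul_neg, neg_neg, mul_assoc]
  have hc : Commute b a := by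
    have := hsq.cfcₙ_nnreal NNReal.sqrt
    rwa [← CFC.sqrt, CFC.sqrt_mul_self b hb] at this
  rw [hc.eq, ← two_smul ℂ (a * b)] at h
  exact (smul_eq_zero.mp h).resolve_left two_ne_zero

/-- If `a * b = 0` for self-adjoint `a`, `b` with `b ^ 2 ≤ a ^ 2`, then `b = 0`. -/
theorem IsSelfAdjoint.eq_zero_of_mul_eq_zero_of_mul_self_le {a b : R}
    (hb : IsSelfAdjoint b) (hab : a * b = 0) (h : 0 ≤ a * a - b * b) : b = 0 := by
  have h1 : 0 ≤ b * (a * a - b * b) * b := hb.conjugate_nonneg h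
  have h2 : b * (a * a - b * b) * b = -(star (b * b) * (b * b)) := by
    rw [star_mul, hb.star_eq]
    have : b * (a * a - b * b) * b = b * a * (a * b) - b * b * (b * b) := by noncomm_ring
    rw [this, hab, mul_zero, zero_sub]
  rw [h2] at h1
  have h3 : star (b * b) * (b * b) = 0 :=
    le_antisymm (neg_nonneg.mp h1) (star_mul_self_nonneg _)
  have h4 := (CStarRing.star_mul_self_eq_zero_iff _).mp h3
  refine (CStarRing.star_mul_self_eq_zero_iff b).mp ?_
  rwa [hb.star_eq]

/-- A self-adjoint element with a nonnegative odd power is nonnegative. -/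
theorem IsSelfAdjoint.nonneg_of_odd_pow_nonneg {a : R} (ha : IsSelfAdjoint a) {n : ℕ}
    (hn : Odd n) (h : 0 ≤ a ^ n) : 0 ≤ a := by
  rw [StarOrderedRing.nonneg_iff_spectrum_nonneg (R := ℝ) a ha]
  intro x hx
  have hxn : x ^ n ∈ spectrum ℝ (a ^ n) := by
    rw [← cfc_pow_id (R := ℝ) a n ha, cfc_map_spectrum (fun x : ℝ ↦ x ^ n) a ha]
    exact ⟨x, hx, rfl⟩
  exact hn.pow_nonneg_iff.mp (spectrum_nonneg_of_nonneg h hxn)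

end CStarAlgebra

theorem positive_of_cube_sq_positive
    {H : Type*} [NormedAddCommGroup H] [InnerProductSpace ℂ H] [CompleteSpace H]
    (T A B : H →L[ℂ] H) (hA : IsSelfAdjoint A) (hB : IsSelfAdjoint B)
    (hT : T = A + Complex.I • B)
    (h3 : (T ^ 3).IsPositive) (h2 : (T ^ 2).IsPositive)
    (hpos : B.IsPositive ∨ (-B).IsPositive) :
    T.IsPositive := by
  have hsq : T ^ 2 = (A * A - B * B) + Complex.I • (A * B + B * A) := by
    rw [hT, sq, add_mul, mul_add, mul_add]
    simp only [smul_mul_assoc, mul_smul_comm, smul_smul, Complex.I_mul_I, smul_add]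
    module
  have hanti : A * B + B * A = 0 := by
    have hs := h2.isSelfAdjoint.star_eq
    rw [hsq] at hs
    simp only [star_add, star_sub, star_mul, star_smul, hA.star_eq, hB.star_eq,
      RCLike.star_def, Complex.conj_I] at hs
    have h0 : (2 * Complex.I) • (A * B + B * A) = 0 := by
      rw [← sub_eq_zero] at hs
      rw [← neg_eq_zero, ← hs]
      module
    exact (smul_eq_zero.mp h0).resolve_left (by simp)
  have hAB : A * B = 0 := by
    rcases hpos with h | h
    · exact mul_eq_zero_of_anticommute_of_nonneg ((nonneg_iff_isPositive B).mpr h) hanti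
    · have := mul_eq_zero_of_anticommute_of_nonneg (a := A)
        ((nonneg_iff_isPositive (-B)).mpr h)
        (by rw [mul_neg, neg_mul, ← neg_add, hanti, neg_zero])
      rwa [mul_neg, neg_eq_zero] at this
  have hB0 : B = 0 := by
    refine hB.eq_zero_of_mul_eq_zero_of_mul_self_le hAB ?_
    rwa [hsq, hanti, smul_zero, add_zero, ← nonneg_iff_isPositive] at h2
  have hTA : T = A := by rw [hT, hB0, smul_zero, add_zero]
  rw [hTA, ← nonneg_iff_isPositive] at h3 ⊢
  exact hA.nonneg_of_odd_pow_nonneg (by decide) h3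
end

section
/- Let H be a complex Hilbert space and let T be a bounded linear operator on H such that T³ and T⁴ are self-adjoint. If Re T ≥ 0 and Re(T²) ≥ 0, then T is self-adjoint. -/
open ContinuousLinearMap

/-- The kernel of an accretive operator is contained in the kernel of its adjoint. -/
theorem adjoint_apply_eq_zero_of_accretive
    {H : Type*} [NormedAddCommGroup H] [InnerProductSpace ℂ H] [CompleteSpace H]
    {T : H →L[ℂ] H} (hT : ∀ x, 0 ≤ (inner ℂ (T x) x).re) {y : H} (hy : T y = 0) :
    adjoint T y = 0 := by
  set z := adjoint T y with hz
  by_contra hne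
  have hpos : 0 < ‖z‖ ^ 2 := by positivity
  have hzy : inner ℂ (T z) y = ((‖z‖ ^ 2 : ℝ) : ℂ) := by
    rw [← adjoint_inner_right, ← hz, inner_self_eq_norm_sq_to_K]
    norm_cast
  have key : ∀ t : ℝ, 0 ≤ (inner ℂ (T z) z).re + t * ‖z‖ ^ 2 := fun t => by
    have h := hT (z + (t : ℂ) • y)
    rwa [map_add, map_smul, hy, smul_zero, add_zero, inner_add_right, inner_smul_right, hzy,
      Complex.add_re, ← Complex.ofReal_mul, Complex.ofReal_re] at h
  have h := key (-((inner ℂ (T z) z).re + 1) / ‖z‖ ^ 2)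
  rw [div_mul_cancel₀ _ hpos.ne'] at h
  linarith

/-- An accretive operator has the same kernel as its square. -/
theorem apply_eq_zero_of_accretive_of_apply_apply_eq_zero
    {H : Type*} [NormedAddCommGroup H] [InnerProductSpace ℂ H] [CompleteSpace H]
    {T : H →L[ℂ] H} (hT : ∀ x, 0 ≤ (inner ℂ (T x) x).re) {x : H} (hx : T (T x) = 0) :
    T x = 0 := by
  have h := adjoint_inner_left T x (T x)
  rw [adjoint_apply_eq_zero_of_accretive hT hx, inner_zero_left] at h
  exact inner_self_eq_zero.mp h.symm

theorem selfAdjoint_of_cube_fourth_selfAdjoint_re_pos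
    {H : Type*} [NormedAddCommGroup H] [InnerProductSpace ℂ H] [CompleteSpace H]
    (T : H →L[ℂ] H) (h3 : IsSelfAdjoint (T ^ 3)) (h4 : IsSelfAdjoint (T ^ 4))
    (hre : (((2 : ℂ)⁻¹) • (T + adjoint T)).IsPositive)
    (hre2 : (((2 : ℂ)⁻¹) • (T ^ 2 + adjoint (T ^ 2))).IsPositive) :
    IsSelfAdjoint T := by
  have hT : ∀ x, 0 ≤ (inner ℂ (T x) x).re := fun x => by
    have h := hre.re_inner_nonneg_left x
    have hsymm : (inner ℂ (adjoint T x) x).re = (inner ℂ (T x) x).re := by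
      rw [adjoint_inner_left, ← inner_conj_symm, Complex.conj_re]
    simp only [smul_apply, add_apply, inner_smul_left, inner_add_left, map_inv₀, map_ofNat,
      RCLike.re_to_complex] at h
    rw [show ((2 : ℂ)⁻¹) = ((2⁻¹ : ℝ) : ℂ) by norm_num, Complex.re_ofReal_mul, Complex.add_re,
      hsymm] at h
    linarith
  have hcube : T ^ 3 * (T - star T) = 0 := by
    have h : T ^ 3 * star T = T ^ 4 := by
      have := h4.star_eq
      rwa [pow_succ', star_mul, h3.star_eq, ← pow_succ'] at this
    rw [mul_sub, h, ← pow_succ, sub_self]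
  rw [isSelfAdjoint_iff', eq_comm, ← sub_eq_zero]
  ext x
  have hker : T ((T - adjoint T) x) = 0 := by
    refine apply_eq_zero_of_accretive_of_apply_apply_eq_zero hT
      (apply_eq_zero_of_accretive_of_apply_apply_eq_zero hT ?_)
    exact DFunLike.congr_fun hcube x
  have hker' := adjoint_apply_eq_zero_of_accretive hT hker
  rw [zero_apply, ← inner_self_eq_zero (𝕜 := ℂ)]
  nth_rewrite 1 [sub_apply]
  rw [inner_sub_left, adjoint_inner_left, hker, ← adjoint_inner_right, hker', inner_zero_right,
    sub_zero]
end

section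
/- Let H be a complex Hilbert space and let T = A + iB be a bounded linear operator on H, where A and B are self-adjoint (the Cartesian decomposition). Let n ∈ ℕ with n ≥ 2. If T^(2n+1) and T² are self-adjoint and A ≥ 0, then T is self-adjoint. -/
open ContinuousLinearMap

/-- A positive operator which anticommutes with `B` annihilates it. -/
theorem ContinuousLinearMap.IsPositive.mul_eq_zero_of_anticommute
    {H : Type*} [NormedAddCommGroup H] [InnerProductSpace ℂ H] [CompleteSpace H]
    {A B : H →L[ℂ] H} (hA : A.IsPositive) (h : A * B = -(B * A)) : A * B = 0 := by
  have : IsAddTorsionFree (H →L[ℂ] H) := .of_isTorsionFree ℂ _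
  have hsq : Commute (A * A) B := by
    rw [commute_iff_eq, mul_assoc, h, mul_neg, ← mul_assoc, h, neg_mul, neg_neg, mul_assoc]
  have hA0 : 0 ≤ A := (nonneg_iff_isPositive A).2 hA
  have hc : Commute (CFC.sqrt (A * A)) B := hsq.cfcₙ_nnreal NNReal.sqrt
  rw [CFC.sqrt_mul_self A hA0] at hc
  rw [hc.eq, self_eq_neg] at h
  rw [hc.eq, h]

/-- A nilpotent self-adjoint element of a C⋆-algebra vanishes. -/
theorem IsSelfAdjoint.eq_zero_of_pow_eq_zero {E : Type*} [NormedRing E] [StarRing E] [CStarRing E]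
    {b : E} (hb : IsSelfAdjoint b) {m : ℕ} (h : b ^ m = 0) : b = 0 := by
  have h0 : b ^ 2 ^ m = 0 := pow_eq_zero_of_le Nat.lt_two_pow_self.le h
  have h1 := hb.nnnorm_pow_two_pow m
  rw [h0, nnnorm_zero] at h1
  exact nnnorm_eq_zero.1 (_root_.eq_zero_of_pow_eq_zero h1.symm)

theorem add_smul_pow_mul_of_mul_eq_zero {R E : Type*} [CommRing R] [Ring E] [Algebra R E]
    {a b : E} (h : a * b = 0) (c : R) (m : ℕ) :
    (a + c • b) ^ m * b = c ^ m • b ^ (m + 1) := by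
  induction m with
  | zero => simp
  | succ m ih =>
    have h' : a * b ^ (m + 1) = 0 := by rw [pow_succ', ← mul_assoc, h, zero_mul]
    rw [pow_succ' (a + c • b), mul_assoc, ih, mul_smul_comm, add_mul, h', zero_add, smul_mul_assoc,
      smul_smul, ← pow_succ, ← pow_succ']

theorem selfAdjoint_of_odd_power_sq_selfAdjoint_re_pos
    {H : Type*} [NormedAddCommGroup H] [InnerProductSpace ℂ H] [CompleteSpace H]
    (T A B : H →L[ℂ] H) (hA : IsSelfAdjoint A) (hB : IsSelfAdjoint B)
    (hT : T = A + Complex.I • B)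
    (n : ℕ) (hn : 2 ≤ n)
    (hodd : IsSelfAdjoint (T ^ (2 * n + 1))) (h2 : IsSelfAdjoint (T ^ 2))
    (hpos : A.IsPositive) :
    IsSelfAdjoint T := by
  have hstar : star T = A + (-Complex.I) • B := by
    simp [hT, hA.star_eq, hB.star_eq]
  have hanti : A * B = -(B * A) := by
    have h := h2.star_eq
    rw [star_pow, hstar, hT] at h
    have h' : (2 * Complex.I) • (A * B + B * A) = 0 := by
      rw [← sub_eq_zero.2 h.symm]
      simp only [sq, add_mul, mul_add, smul_mul_assoc, mul_smul_comm]
      module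
    exact eq_neg_of_add_eq_zero_left ((smul_eq_zero.1 h').resolve_left (by simp))
  have hAB := hpos.mul_eq_zero_of_anticommute hanti
  have hpow : B ^ (2 * n + 1 + 1) = 0 := by
    have : IsAddTorsionFree (H →L[ℂ] H) := .of_isTorsionFree ℂ _
    have h := congrArg (· * B) hodd.star_eq
    simp only [star_pow] at h
    rw [hstar, hT, add_smul_pow_mul_of_mul_eq_zero hAB, add_smul_pow_mul_of_mul_eq_zero hAB,
      Odd.neg_pow ⟨n, rfl⟩, neg_smul, neg_eq_self] at h
    exact (smul_eq_zero.1 h).resolve_left (by simp)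
  rw [hT, hB.eq_zero_of_pow_eq_zero hpow, smul_zero, add_zero]
  exact hA
end

section
/- Let H be a complex Hilbert space, let n ∈ ℕ with n ≥ 2, and let T be a bounded linear operator on H such that T^(2n+1) is self-adjoint and Re T ≥ 0. Then T is self-adjoint if and only if T² is self-adjoint. -/
open ContinuousLinearMap

/-- A nilpotent skew-adjoint element of a C⋆-ring vanishes. -/
theorem eq_zero_of_star_eq_neg_of_pow_eq_zero {A : Type*} [NormedRing A] [StarRing A]
    [CStarRing A] {x : A} (hx : star x = -x) (n : ℕ) (hn : x ^ n = 0) : x = 0 := by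
  induction n using Nat.strong_induction_on with
  | _ n ih =>
    rcases Nat.lt_or_ge n 2 with h | h
    · interval_cases n
      · rw [← one_mul x, ← pow_zero x, hn, zero_mul]
      · simpa using hn
    · refine ih ((n + 1) / 2) (by omega) ?_
      rw [← CStarRing.star_mul_self_eq_zero_iff, star_pow, hx, neg_pow, mul_assoc, ← pow_add,
        pow_eq_zero_of_le (by omega : n ≤ (n + 1) / 2 + (n + 1) / 2) hn, mul_zero]

/-- If `a ≥ 0` anticommutes with a skew-adjoint `d` and `(a ^ 2 + d ^ 2) * d = 0`,
then `d = 0`. -/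
theorem eq_zero_of_nonneg_of_anticommute {A : Type*} [NormedRing A] [StarRing A]
    [CStarRing A] [PartialOrder A] [StarOrderedRing A] {a d : A} (ha : 0 ≤ a)
    (hd : star d = -d) (had : a * d = -(d * a)) (h : a * a * d = -(d * d * d)) : d = 0 := by
  have hsa : star a = a := (IsSelfAdjoint.of_nonneg ha).star_eq
  have hcomm : a * (d * d) = d * d * a := by
    rw [← mul_assoc, had, neg_mul, mul_assoc, had, mul_neg, neg_neg, mul_assoc]
  have h₁ : 0 ≤ d * d * a * (d * d) := by
    simpa [hd] using star_left_conjugate_nonneg ha (d * d)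
  have h₂ : 0 ≤ -(d * a * a * (a * d)) := by
    simpa [hd, hsa, mul_assoc] using star_left_conjugate_nonneg ha (a * d)
  have h₃ : -(d * a * a * (a * d)) = -(d * d * a * (d * d)) := by
    rw [neg_inj]
    calc d * a * a * (a * d) = d * a * (a * a * d) := by simp only [mul_assoc]
      _ = -(d * (a * (d * d)) * d) := by rw [h]; simp only [mul_neg, mul_assoc]
      _ = -(d * (d * d) * (a * d)) := by rw [hcomm]; simp only [mul_assoc]
      _ = d * d * (d * d) * a := by rw [had]; simp only [mul_neg, neg_neg, mul_assoc]
      _ = d * d * a * (d * d) := by rw [mul_assoc (d * d) a, hcomm]; simp only [mul_assoc]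
  have h₄ : a * (d * d) * (d * d) = 0 := by
    rw [hcomm]
    exact le_antisymm (neg_nonneg.mp (h₃ ▸ h₂)) h₁
  refine eq_zero_of_star_eq_neg_of_pow_eq_zero hd 7 ?_
  calc d ^ 7 = -(-(d * d * d) * (d * d * (d * d))) := by noncomm_ring
    _ = -(a * (a * d * (d * d * (d * d)))) := by rw [← h]; simp only [mul_assoc]
    _ = -(a * (a * (d * d) * (d * d) * d)) := by simp only [mul_assoc]
    _ = 0 := by rw [h₄]; simp

/-- In a C⋆-ring, an element with nonnegative real part is self-adjoint as soon as its square and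
one of its odd powers are. -/
theorem isSelfAdjoint_of_sq_of_odd_pow {A : Type*} [NormedRing A] [StarRing A]
    [CStarRing A] [PartialOrder A] [StarOrderedRing A] {t : A} (n : ℕ)
    (hodd : IsSelfAdjoint (t ^ (2 * n + 1))) (hre : 0 ≤ t + star t)
    (hsq : IsSelfAdjoint (t ^ 2)) : IsSelfAdjoint t := by
  have hs : star t * star t = t * t := by simpa [pow_two] using hsq.star_eq
  have hct : Commute (t ^ 2) t := Commute.pow_self t 2
  have hcd : Commute (t ^ 2) (t - star t) := by
    refine hct.sub_right ?_
    simpa [hsq.star_eq] using hct.star_star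
  have hd : star (t - star t) = -(t - star t) := by simp
  have hzero : (t ^ 2) ^ n * (t - star t) = 0 := by
    have h := hodd.star_eq
    rw [pow_succ, pow_mul, star_mul, star_pow, hsq.star_eq] at h
    have hc : Commute ((t ^ 2) ^ n) (star t) := by
      simpa [hsq.star_eq] using (hct.pow_left n).star_star
    rw [mul_sub, hc.eq, h, sub_self]
  have hSD : t ^ 2 * (t - star t) = 0 := by
    refine eq_zero_of_star_eq_neg_of_pow_eq_zero ?_ (n + 1) ?_
    · rw [star_mul, hsq.star_eq, hd, neg_mul, hcd.eq]
    · rw [hcd.mul_pow, pow_succ (t ^ 2), pow_succ' (t - star t), mul_assoc,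
        ← mul_assoc (t ^ 2) (t - star t), hcd.eq, mul_assoc, ← mul_assoc, ← mul_assoc,
        hzero, zero_mul, zero_mul]
  have hanti : (t + star t) * (t - star t) = -((t - star t) * (t + star t)) := by
    simp only [add_mul, mul_add, sub_mul, mul_sub, hs]
    abel
  have hsum : (t + star t) * (t + star t) + (t - star t) * (t - star t) = 4 • t ^ 2 := by
    simp only [add_mul, mul_add, sub_mul, mul_sub, hs, pow_two]
    abel
  have hmul : (t + star t) * (t + star t) * (t - star t) =
      -((t - star t) * (t - star t) * (t - star t)) := by
    rw [← add_eq_zero_iff_eq_neg, ← add_mul, hsum, smul_mul_assoc, hSD, smul_zero]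
  exact (sub_eq_zero.mp (eq_zero_of_nonneg_of_anticommute hre hd hanti hmul)).symm

theorem selfAdjoint_iff_sq_selfAdjoint_of_odd_power
    {H : Type*} [NormedAddCommGroup H] [InnerProductSpace ℂ H] [CompleteSpace H]
    (T : H →L[ℂ] H) (n : ℕ) (hn : 2 ≤ n)
    (hodd : IsSelfAdjoint (T ^ (2 * n + 1)))
    (hre : (((2 : ℂ)⁻¹) • (T + adjoint T)).IsPositive) :
    IsSelfAdjoint T ↔ IsSelfAdjoint (T ^ 2) := by
  refine ⟨fun h => h.pow 2, isSelfAdjoint_of_sq_of_odd_pow n hodd ?_⟩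
  rw [nonneg_iff_isPositive, star_eq_adjoint]
  open scoped ComplexOrder in
  simpa [smul_smul] using hre.smul_of_nonneg (zero_le_two : (0 : ℂ) ≤ 2)
end

section
/- Let H be a complex Hilbert space and let T be a bounded linear operator on H such that T³ = 0. If Re(T²) ≥ 0 or Im(T²) ≥ 0, then T² = 0. -/
open ContinuousLinearMap

/-- A square-zero operator whose rotated real part `c • A + conj c • A†` is positive for some
nonzero `c` vanishes. -/
theorem eq_zero_of_mul_self_eq_zero_of_isPositive
    {H : Type*} [NormedAddCommGroup H] [InnerProductSpace ℂ H] [CompleteSpace H]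
    {A : H →L[ℂ] H} (hA : A * A = 0) {c : ℂ} (hc : c ≠ 0)
    (hpos : (c • A + (starRingEnd ℂ c) • adjoint A).IsPositive) : A = 0 := by
  have key : ∀ x, 0 ≤ (starRingEnd ℂ c * inner ℂ (A x) x).re := by
    intro x
    have h : 0 ≤ (inner ℂ ((c • A + (starRingEnd ℂ c) • adjoint A) x) x).re :=
      hpos.re_inner_nonneg_left x
    have hx : inner ℂ x (A x) = starRingEnd ℂ (inner ℂ (A x) x) :=
      (inner_conj_symm x (A x)).symm
    simp only [add_apply, smul_apply, inner_add_left, inner_smul_left, adjoint_inner_left, hx,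
      Complex.conj_conj, Complex.add_re, Complex.mul_re, Complex.conj_re, Complex.conj_im] at h
    simp only [Complex.mul_re, Complex.conj_re, Complex.conj_im]
    linarith
  ext x
  have hAA : A (A x) = 0 := congrArg (fun B : H →L[ℂ] H => B x) hA
  by_contra hx
  have hn : 0 < Complex.normSq c * ‖A x‖ ^ 2 :=
    mul_pos (Complex.normSq_pos.2 hc) (pow_pos (norm_pos_iff.2 hx) 2)
  have bound : ∀ t : ℝ, 0 ≤ (starRingEnd ℂ c * inner ℂ (A x) x).re
      - t * (Complex.normSq c * ‖A x‖ ^ 2) := by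
    intro t
    have h := key (x + (-(t : ℂ) * c) • A x)
    have hsq : inner ℂ (A x) (A x) = ((‖A x‖ ^ 2 : ℝ) : ℂ) := by
      rw [inner_self_eq_norm_sq_to_K]
      push_cast
      rfl
    have e : starRingEnd ℂ c * inner ℂ (A (x + (-(t : ℂ) * c) • A x)) (x + (-(t : ℂ) * c) • A x)
        = starRingEnd ℂ c * inner ℂ (A x) x
          - ((t * (Complex.normSq c * ‖A x‖ ^ 2) : ℝ) : ℂ) := by
      rw [map_add, map_smul, hAA, smul_zero, add_zero, inner_add_right, inner_smul_right, hsq]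
      push_cast
      rw [Complex.normSq_eq_conj_mul_self]
      ring
    rwa [e, Complex.sub_re, Complex.ofReal_re] at h
  have h := bound (((starRingEnd ℂ c * inner ℂ (A x) x).re + 1) / (Complex.normSq c * ‖A x‖ ^ 2))
  rw [div_mul_cancel₀ _ hn.ne'] at h
  linarith

theorem sq_eq_zero_of_cube_eq_zero_pos
    {H : Type*} [NormedAddCommGroup H] [InnerProductSpace ℂ H] [CompleteSpace H]
    (T : H →L[ℂ] H) (h3 : T ^ 3 = 0)
    (hpos : (((2 : ℂ)⁻¹) • (T ^ 2 + adjoint (T ^ 2))).IsPositive ∨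
      (((2 * Complex.I)⁻¹) • (T ^ 2 - adjoint (T ^ 2))).IsPositive) :
    T ^ 2 = 0 := by
  have hA : T ^ 2 * T ^ 2 = 0 := by
    rw [← pow_add, pow_succ, h3, zero_mul]
  rcases hpos with h | h
  · refine eq_zero_of_mul_self_eq_zero_of_isPositive hA (c := (2 : ℂ)⁻¹) (by simp) ?_
    have hc : starRingEnd ℂ (2 : ℂ)⁻¹ = (2 : ℂ)⁻¹ := by simp [Complex.conj_ofNat]
    rwa [hc, ← smul_add]
  · refine eq_zero_of_mul_self_eq_zero_of_isPositive hA (c := (2 * Complex.I)⁻¹) (by simp) ?_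
    have hc : starRingEnd ℂ (2 * Complex.I)⁻¹ = -(2 * Complex.I)⁻¹ := by simp [Complex.conj_ofNat]
    rwa [hc, neg_smul, ← sub_eq_add_neg, ← smul_sub]
end

section
/- Let H be a complex Hilbert space and let T be a bounded linear operator on H such that T³ = 0. If Re(T²) ≤ 0 or Im(T²) ≤ 0, then T² = 0. -/
open ContinuousLinearMap

/-- A square-zero operator with nonpositive real part vanishes. -/
theorem eq_zero_of_mul_self_eq_zero_of_isPositive_neg_add_adjoint
    {H : Type*} [NormedAddCommGroup H] [InnerProductSpace ℂ H] [CompleteSpace H]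
    (R : H →L[ℂ] H) (hR : R * R = 0) (hpos : (-(R + adjoint R)).IsPositive) : R = 0 := by
  have hre : ∀ z, (inner ℂ (R z) z).re ≤ 0 := by
    intro z
    have h := hpos.re_inner_nonneg_left z
    have hsymm : (inner ℂ z (R z)).re = (inner ℂ (R z) z).re :=
      inner_re_symm (𝕜 := ℂ) z (R z)
    simp only [neg_apply, add_apply, inner_neg_left, inner_add_left, adjoint_inner_left,
      map_neg, map_add, RCLike.re_to_complex, hsymm] at h
    linarith
  ext x
  by_contra hx
  have hRR : R (R x) = 0 := by
    simpa using congrArg (fun A : H →L[ℂ] H => A x) hR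
  have hn : 0 < ‖R x‖ ^ 2 := by
    have : 0 < ‖R x‖ := norm_pos_iff.mpr hx
    positivity
  set a := (inner ℂ (R x) x).re with ha
  have h := hre (x + (((1 - a) / ‖R x‖ ^ 2 : ℝ) : ℂ) • R x)
  rw [map_add, map_smul, hRR, smul_zero, add_zero, inner_add_right, inner_smul_right,
    Complex.add_re, Complex.re_ofReal_mul, ← ha, inner_self_eq_norm_sq_to_K] at h
  have hc : (((‖R x‖ : ℝ) : ℂ) ^ 2).re = ‖R x‖ ^ 2 := by
    rw [← Complex.ofReal_pow, Complex.ofReal_re]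
  erw [hc] at h
  rw [div_mul_cancel₀ _ hn.ne'] at h
  linarith

theorem sq_eq_zero_of_cube_eq_zero_neg
    {H : Type*} [NormedAddCommGroup H] [InnerProductSpace ℂ H] [CompleteSpace H]
    (T : H →L[ℂ] H) (h3 : T ^ 3 = 0)
    (hneg : (-(((2 : ℂ)⁻¹) • (T ^ 2 + adjoint (T ^ 2)))).IsPositive ∨
      (-(((2 * Complex.I)⁻¹) • (T ^ 2 - adjoint (T ^ 2)))).IsPositive) :
    T ^ 2 = 0 := by
  have hsq : T ^ 2 * T ^ 2 = 0 := by
    rw [← pow_add, show 2 + 2 = 3 + 1 from rfl, pow_succ, h3, zero_mul]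
  have key : ∀ c : ℂ, c ≠ 0 → (-(c • T ^ 2 + adjoint (c • T ^ 2))).IsPositive → T ^ 2 = 0 := by
    intro c hc hpos
    have h := eq_zero_of_mul_self_eq_zero_of_isPositive_neg_add_adjoint (c • T ^ 2)
      (by rw [smul_mul_smul_comm, hsq, smul_zero]) hpos
    exact (smul_eq_zero.mp h).resolve_left hc
  rcases hneg with h | h
  · refine key 2⁻¹ (by simp) ?_
    have hstar : (starRingEnd ℂ) (2 : ℂ)⁻¹ = 2⁻¹ := by simp [Complex.conj_ofNat]
    rwa [map_smulₛₗ, hstar, ← smul_add]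
  · refine key (2 * Complex.I)⁻¹ (by simp) ?_
    have hstar : (starRingEnd ℂ) (2 * Complex.I)⁻¹ = -(2 * Complex.I)⁻¹ := by simp [Complex.conj_ofNat]
    rwa [map_smulₛₗ, hstar, neg_smul, ← sub_eq_add_neg, ← smul_sub]
end

section
/- Let H be a complex Hilbert space and let T be a bounded linear operator on H such that T³ = 0 and Re(T²) ≥ 0 or Im(T²) ≥ 0. Then T is complex symmetric: there exists a conjugation C on H (a continuous conjugate-linear map C : H → H with C∘C = id and ‖Cx‖ = ‖x‖ for all x) such that T = C ∘ T* ∘ C. -/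
open ContinuousLinearMap

section RealForms

variable {H : Type*} [NormedAddCommGroup H] [InnerProductSpace ℂ H]

/-- The vectors whose inner products with all elements of `S` are real. -/
def realInnerCompl (S : Set H) : Submodule ℝ H where
  carrier := {v | ∀ s ∈ S, (inner ℂ s v).im = 0}
  add_mem' := by
    intro a b ha hb s hs
    simp [ha s hs, hb s hs]
  zero_mem' := by
    intro s _
    simp
  smul_mem' := by
    intro c x hx s hs
    rw [← Complex.coe_smul, inner_smul_right]
    simp [hx s hs]

theorem mem_realInnerCompl {S : Set H} {v : H} :
    v ∈ realInnerCompl S ↔ ∀ s ∈ S, (inner ℂ s v).im = 0 := Iff.rfl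

theorem isClosed_realInnerCompl (S : Set H) : IsClosed (realInnerCompl S : Set H) := by
  have h : (realInnerCompl S : Set H) = ⋂ s ∈ S, {v | (inner ℂ s v).im = 0} := by
    ext v
    simp [mem_realInnerCompl]
  rw [h]
  refine isClosed_biInter fun s _ => isClosed_eq ?_ continuous_const
  fun_prop

theorem inner_im_eq_zero_symm {x y : H} (h : (inner ℂ x y).im = 0) : (inner ℂ y x).im = 0 := by
  rw [← inner_conj_symm, Complex.conj_im, h, neg_zero]

/-- A closed real subspace with real inner products whose complex orthogonal complement is trivial
is the fixed space of a conjugation. -/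
theorem exists_conjugation_of_real_form [CompleteSpace H] (R : Submodule ℝ H)
    (hR : IsClosed (R : Set H)) (him : ∀ x ∈ R, ∀ y ∈ R, (inner ℂ x y).im = 0)
    (hperp : ∀ w, (∀ s ∈ R, inner ℂ s w = 0) → w = 0) :
    ∃ C : H →SL[starRingEnd ℂ] H, (∀ x, C (C x) = x) ∧ (∀ x, ‖C x‖ = ‖x‖) ∧
      (∀ x ∈ R, C x = x) ∧ ∀ x, ∃ s ∈ R, ∃ t ∈ R, x = s + Complex.I • t := by
  let _ : InnerProductSpace ℝ H := InnerProductSpace.complexToReal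
  have : CompleteSpace R := hR.completeSpace_coe
  have hre (x y : H) : inner ℝ x y = (inner ℂ x y).re := rfl
  have hI : ∀ t ∈ R, Complex.I • t ∈ Rᗮ := by
    intro t ht
    rw [Submodule.mem_orthogonal]
    intro s hs
    rw [hre, inner_smul_right]
    simp [him s hs t ht]
  have hdec : ∀ x, ∃ s ∈ R, ∃ t ∈ R, x = s + Complex.I • t := by
    intro x
    obtain ⟨s, hs, v, hv, rfl⟩ := R.exists_add_mem_mem_orthogonal x
    obtain ⟨u, hu, w, hw, huw⟩ := R.exists_add_mem_mem_orthogonal (-Complex.I • v)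
    have hvw : v = Complex.I • u + Complex.I • w := by
      rw [← smul_add, ← huw, smul_smul]
      simp
    have hw0 : w = 0 := by
      apply hperp
      intro r hr
      have h1 := (Submodule.mem_orthogonal _ _).1 hw r hr
      have h2 : Complex.I • w ∈ Rᗮ := by
        rw [eq_sub_of_add_eq' hvw.symm]
        exact sub_mem hv (hI u hu)
      have h3 := (Submodule.mem_orthogonal _ _).1 h2 r hr
      rw [hre] at h1
      rw [hre, inner_smul_right] at h3
      apply Complex.ext
      · exact h1
      · simpa using h3
    refine ⟨s, hs, u, hu, ?_⟩
    rw [hvw, hw0]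
    simp
  have hfix : ∀ x ∈ R, R.reflection x = x := fun x hx =>
    Submodule.reflection_mem_subspace_eq_self hx
  have hneg : ∀ x ∈ R, R.reflection (Complex.I • x) = -(Complex.I • x) := fun x hx =>
    Submodule.reflection_mem_subspace_orthogonalComplement_eq_neg (hI x hx)
  have hsmulI : ∀ x, R.reflection (Complex.I • x) = -(Complex.I • R.reflection x) := by
    intro x
    obtain ⟨s, hs, t, ht, rfl⟩ := hdec x
    have : Complex.I • (s + Complex.I • t) = Complex.I • s - t := by
      rw [smul_add, smul_smul]
      simp [sub_eq_add_neg]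
    rw [this, map_sub, map_add, hneg s hs, hneg t ht, hfix s hs, hfix t ht, smul_add, smul_neg,
      smul_smul]
    simp
    abel
  let L : H →ₛₗ[starRingEnd ℂ] H :=
    { toFun := R.reflection
      map_add' := map_add _
      map_smul' := by
        intro z x
        have hz : ∀ y : H, z • y = z.re • y + z.im • (Complex.I • y) := by
          intro y
          rw [← Complex.coe_smul, ← Complex.coe_smul, smul_smul, ← add_smul, Complex.re_add_im]
        have hz' : ∀ y : H, (starRingEnd ℂ) z • y = z.re • y - z.im • (Complex.I • y) := by
          intro y
          rw [← Complex.coe_smul, ← Complex.coe_smul, smul_smul, ← sub_smul]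
          congr 1
          apply Complex.ext <;> simp
        rw [hz, hz', map_add, map_smul, map_smul, hsmulI, smul_neg, sub_eq_add_neg] }
  refine ⟨⟨L, R.reflection.continuous⟩, R.reflection_reflection, fun x => R.reflection.norm_map x,
    hfix, hdec⟩

end RealForms

section SquareZero

variable {H : Type*} [NormedAddCommGroup H] [InnerProductSpace ℂ H] [CompleteSpace H]

/-- A set with real inner products that is invariant under `T + T*` and `i (T - T*)`. -/
structure IsRealInvariant (T : H →L[ℂ] H) (S : Set H) : Prop where
  inner_im : ∀ x ∈ S, ∀ y ∈ S, (inner ℂ x y).im = 0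
  add_mem : ∀ x ∈ S, T x + adjoint T x ∈ S
  sub_mem : ∀ x ∈ S, Complex.I • (T x - adjoint T x) ∈ S

theorem inner_add_adjoint_apply (T : H →L[ℂ] H) (x y : H) :
    inner ℂ x (T y + adjoint T y) = inner ℂ (T x + adjoint T x) y := by
  rw [inner_add_right, inner_add_left, adjoint_inner_left, adjoint_inner_right, add_comm]

theorem inner_I_smul_sub_adjoint_apply (T : H →L[ℂ] H) (x y : H) :
    inner ℂ x (Complex.I • (T y - adjoint T y)) = inner ℂ (Complex.I • (T x - adjoint T x)) y := by
  rw [inner_smul_right, inner_smul_left, inner_sub_right, inner_sub_left, adjoint_inner_left,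
    adjoint_inner_right, Complex.conj_I]
  ring

theorem IsRealInvariant.union {T : H →L[ℂ] H} {S O : Set H} (hS : IsRealInvariant T S)
    (hO : IsRealInvariant T O) (h : ∀ x ∈ S, ∀ y ∈ O, inner ℂ x y = 0) :
    IsRealInvariant T (S ∪ O) where
  inner_im := by
    rintro x (hx | hx) y (hy | hy)
    · exact hS.inner_im x hx y hy
    · simp [h x hx y hy]
    · exact inner_im_eq_zero_symm (by simp [h y hy x hx])
    · exact hO.inner_im x hx y hy
  add_mem := by
    rintro x (hx | hx)
    · exact Or.inl (hS.add_mem x hx)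
    · exact Or.inr (hO.add_mem x hx)
  sub_mem := by
    rintro x (hx | hx)
    · exact Or.inl (hS.sub_mem x hx)
    · exact Or.inr (hO.sub_mem x hx)

theorem IsRealInvariant.bicompl {T : H →L[ℂ] H} {S : Set H} (hS : IsRealInvariant T S) :
    IsRealInvariant T (realInnerCompl (realInnerCompl S : Set H) : Set H) := by
  have hsub : ∀ x ∈ S, x ∈ realInnerCompl S := fun x hx s hs => hS.inner_im s hs x hx
  have key : ∀ S' : Set H, (∀ x ∈ S', T x + adjoint T x ∈ S') →
      (∀ x ∈ S', Complex.I • (T x - adjoint T x) ∈ S') →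
      (∀ x ∈ realInnerCompl S', T x + adjoint T x ∈ realInnerCompl S') ∧
      (∀ x ∈ realInnerCompl S', Complex.I • (T x - adjoint T x) ∈ realInnerCompl S') := by
    intro S' h1 h2
    constructor
    · intro x hx s hs
      rw [inner_add_adjoint_apply]
      exact hx _ (h1 s hs)
    · intro x hx s hs
      rw [inner_I_smul_sub_adjoint_apply]
      exact hx _ (h2 s hs)
  have h1 := key S hS.add_mem hS.sub_mem
  have h2 := key _ h1.1 h1.2
  refine ⟨fun x hx y hy => hy x fun s hs => hx s (hsub s hs), h2.1, h2.2⟩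

theorem exists_maximal_isRealInvariant (T : H →L[ℂ] H) :
    ∃ S, Maximal (IsRealInvariant T) S := by
  refine zorn_subset {S | IsRealInvariant T S} fun c hc hchain => ?_
  refine ⟨⋃₀ c, ⟨?_, ?_, ?_⟩, fun s hs => Set.subset_sUnion_of_mem hs⟩
  · rintro x ⟨s, hs, hx⟩ y ⟨t, ht, hy⟩
    rcases hchain.total hs ht with hst | hst
    · exact (hc ht).inner_im x (hst hx) y hy
    · exact (hc hs).inner_im x hx y (hst hy)
  · rintro x ⟨s, hs, hx⟩
    exact ⟨s, hs, (hc hs).add_mem x hx⟩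
  · rintro x ⟨s, hs, hx⟩
    exact ⟨s, hs, (hc hs).sub_mem x hx⟩

theorem commute_starProjection_of_invariant (T : H →L[ℂ] H) (M : Submodule ℂ H)
    [M.HasOrthogonalProjection] (hT : ∀ x ∈ M, T x ∈ M) (hT' : ∀ x ∈ M, adjoint T x ∈ M) :
    Commute T M.starProjection := by
  ext x
  simp only [mul_apply_eq_comp]
  symm
  refine Submodule.eq_starProjection_of_mem_orthogonal (hT _ (M.starProjection_apply_mem x)) ?_
  rw [← map_sub, Submodule.mem_orthogonal]
  intro u hu
  rw [← adjoint_inner_left]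
  exact (Submodule.mem_orthogonal _ _).1 (M.sub_starProjection_mem_orthogonal x) _ (hT' u hu)

theorem abs_apply_mem_of_invariant (T : H →L[ℂ] H) (M : Submodule ℂ H)
    [M.HasOrthogonalProjection] (hT : ∀ x ∈ M, T x ∈ M) (hT' : ∀ x ∈ M, adjoint T x ∈ M)
    {x : H} (hx : x ∈ M) : CFC.abs T x ∈ M := by
  have h := commute_starProjection_of_invariant T M hT hT'
  have h' : Commute T (star M.starProjection) := by
    rwa [(isSelfAdjoint_starProjection M).star_eq]
  have h2 := DFunLike.congr_fun (h.cfcAbs_left h').eq x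
  simp only [mul_apply_eq_comp] at h2
  rw [Submodule.starProjection_eq_self_iff.2 hx] at h2
  rw [h2]
  exact M.starProjection_apply_mem _

theorem inner_abs_apply (T : H →L[ℂ] H) (x y : H) :
    inner ℂ (CFC.abs T x) y = inner ℂ x (CFC.abs T y) := by
  have h : IsSelfAdjoint (CFC.abs T) := (CFC.abs_nonneg T).isSelfAdjoint
  rw [← adjoint_inner_right, ← star_eq_adjoint, h.star_eq]

theorem abs_apply_abs_apply (T : H →L[ℂ] H) (x : H) :
    CFC.abs T (CFC.abs T x) = adjoint T (T x) :=
  DFunLike.congr_fun (CFC.abs_mul_abs T) x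

theorem inner_abs_abs (T : H →L[ℂ] H) (x y : H) :
    inner ℂ (CFC.abs T x) (CFC.abs T y) = inner ℂ (T x) (T y) := by
  rw [inner_abs_apply, abs_apply_abs_apply, adjoint_inner_right]

theorem inner_abs_pow_apply_im (T : H →L[ℂ] H) (w : H) (k : ℕ) :
    (inner ℂ w ((CFC.abs T ^ k) w)).im = 0 := by
  have h : IsSelfAdjoint (CFC.abs T ^ k) := (CFC.abs_nonneg T).isSelfAdjoint.pow k
  rw [← Complex.conj_eq_iff_im, inner_conj_symm, ← adjoint_inner_right, ← star_eq_adjoint,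
    h.star_eq]

theorem inner_abs_pow_apply (T : H →L[ℂ] H) (x y : H) (k : ℕ) :
    inner ℂ ((CFC.abs T ^ k) x) y = inner ℂ x ((CFC.abs T ^ k) y) := by
  have h : IsSelfAdjoint (CFC.abs T ^ k) := (CFC.abs_nonneg T).isSelfAdjoint.pow k
  rw [← adjoint_inner_right, ← star_eq_adjoint, h.star_eq]

theorem abs_apply_apply_of_sq_eq_zero {T : H →L[ℂ] H} (hT : ∀ x, T (T x) = 0)
    (x : H) : CFC.abs T (T x) = 0 := by
  rw [← inner_self_eq_zero (𝕜 := ℂ), inner_abs_abs, hT, inner_zero_left]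

theorem adjoint_abs_apply_of_sq_eq_zero {T : H →L[ℂ] H} (hT : ∀ x, T (T x) = 0)
    (x : H) : adjoint T (CFC.abs T x) = 0 := by
  apply ext_inner_right ℂ
  intro v
  rw [adjoint_inner_left, inner_abs_apply, abs_apply_apply_of_sq_eq_zero hT, inner_zero_left,
    inner_zero_right]

theorem isRealInvariant_orbit {T : H →L[ℂ] H} (hT : ∀ x, T (T x) = 0) (w : H) :
    IsRealInvariant T {v | ∃ (k : ℕ) (c : ℝ), let u := (c : ℂ) • (CFC.abs T ^ k) w
      v = CFC.abs T u + T u ∨ v = Complex.I • (T u - CFC.abs T u)} := by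
  have hPT := abs_apply_apply_of_sq_eq_zero hT
  have horth : ∀ x y, inner ℂ (CFC.abs T x) (T y) = 0 := by
    intro x y
    rw [inner_abs_apply, hPT, inner_zero_right]
  have horth' : ∀ x y, inner ℂ (T x) (CFC.abs T y) = 0 := by
    intro x y
    rw [← inner_conj_symm, horth, map_zero]
  have hstep : ∀ (k : ℕ) (c : ℂ), c • (CFC.abs T ^ (k + 1)) w
      = CFC.abs T (c • (CFC.abs T ^ k) w) := by
    intro k c
    rw [pow_succ', mul_apply_eq_comp, map_smul]
  have hreal : ∀ (k l : ℕ) (c d : ℝ), (inner ℂ (T ((c : ℂ) • (CFC.abs T ^ k) w))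
      (T ((d : ℂ) • (CFC.abs T ^ l) w))).im = 0 := by
    intro k l c d
    rw [← inner_abs_abs, ← hstep, ← hstep, inner_smul_left, inner_smul_right, inner_abs_pow_apply,
      ← mul_apply_eq_comp, ← pow_add]
    rw [Complex.mul_im, Complex.mul_im, Complex.mul_re, inner_abs_pow_apply_im]
    simp
  refine ⟨?_, ?_, ?_⟩
  · rintro x ⟨k, c, hx⟩ y ⟨l, d, hy⟩
    have hkl := hreal k l c d
    dsimp only at hx hy
    set u := (c : ℂ) • (CFC.abs T ^ k) w
    set v := (d : ℂ) • (CFC.abs T ^ l) w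
    rcases hx with rfl | rfl <;> rcases hy with rfl | rfl <;>
      simp [horth, horth', inner_abs_abs, hkl, -map_smul]
  · rintro x ⟨k, c, hx⟩
    dsimp only at hx
    rcases hx with rfl | rfl
    · refine ⟨k + 1, c, Or.inl ?_⟩
      rw [hstep, abs_apply_abs_apply, map_add, map_add, hT, adjoint_abs_apply_of_sq_eq_zero hT]
      abel
    · refine ⟨k + 1, -c, Or.inr ?_⟩
      rw [hstep, abs_apply_abs_apply, Complex.ofReal_neg, neg_smul, map_smul _ Complex.I, map_smul _ Complex.I, map_sub,
        map_sub, hT, adjoint_abs_apply_of_sq_eq_zero hT, ← smul_add]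
      simp only [map_neg]
      congr 1
      abel
  · rintro x ⟨k, c, hx⟩
    dsimp only at hx
    rcases hx with rfl | rfl
    · refine ⟨k + 1, c, Or.inr ?_⟩
      rw [hstep, abs_apply_abs_apply, map_add, map_add, hT, adjoint_abs_apply_of_sq_eq_zero hT]
      congr 1
      abel
    · refine ⟨k + 1, c, Or.inl ?_⟩
      rw [hstep, abs_apply_abs_apply, map_smul _ Complex.I, map_smul _ Complex.I, map_sub,
        map_sub, hT, adjoint_abs_apply_of_sq_eq_zero hT, ← smul_sub, smul_smul, Complex.I_mul_I]
      simp only [neg_smul, one_smul]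
      abel

theorem eq_zero_of_inner_maximal_eq_zero {T : H →L[ℂ] H} (hT : ∀ x, T (T x) = 0)
    {S : Set H} (hS : Maximal (IsRealInvariant T) S) {w : H} (hw : ∀ s ∈ S, inner ℂ s w = 0) : w = 0 := by
  have hmem {v : H} : v ∈ (Submodule.span ℂ S)ᗮ ↔ ∀ s ∈ S, inner ℂ s v = 0 := by
    refine ⟨fun h s hs => (Submodule.mem_orthogonal _ _).1 h s (Submodule.subset_span hs),
      fun h => (Submodule.mem_orthogonal _ _).2 fun u hu => ?_⟩
    induction hu using Submodule.span_induction with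
    | mem x hx => exact h x hx
    | zero => exact inner_zero_left _
    | add x y _ _ hx hy => rw [inner_add_left, hx, hy, add_zero]
    | smul a x _ hx => rw [inner_smul_left, hx, mul_zero]
  set M := (Submodule.span ℂ S)ᗮ
  have hsum : ∀ v ∈ M, T v + adjoint T v ∈ M := by
    intro v hv
    refine hmem.2 fun s hs => ?_
    rw [inner_add_adjoint_apply]
    exact hmem.1 hv _ (hS.prop.add_mem s hs)
  have hdiff : ∀ v ∈ M, T v - adjoint T v ∈ M := by
    intro v hv
    have h : Complex.I • (T v - adjoint T v) ∈ M := by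
      refine hmem.2 fun s hs => ?_
      rw [inner_I_smul_sub_adjoint_apply]
      exact hmem.1 hv _ (hS.prop.sub_mem s hs)
    exact (Submodule.smul_mem_iff _ Complex.I_ne_zero).1 h
  have hTM : ∀ v ∈ M, T v ∈ M := by
    intro v hv
    have h : (2 : ℂ) • T v ∈ M := by
      have h := add_mem (hsum v hv) (hdiff v hv)
      rwa [add_add_sub_cancel, ← two_smul ℂ] at h
    exact (Submodule.smul_mem_iff _ two_ne_zero).1 h
  have hTM' : ∀ v ∈ M, adjoint T v ∈ M := by
    intro v hv
    have h := sub_mem (hsum v hv) (hTM v hv)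
    rwa [add_sub_cancel_left] at h
  have hPM : ∀ v ∈ M, CFC.abs T v ∈ M := fun v hv => abs_apply_mem_of_invariant T M hTM hTM' hv
  have hext : ∀ O : Set H, IsRealInvariant T O → (∀ v ∈ O, v ∈ M) → ∀ v ∈ O, v = 0 := by
    intro O hO hOM v hv
    have hle := hS.le_of_ge (hS.prop.union hO fun x hx y hy => hmem.1 (hOM y hy) x hx)
      Set.subset_union_left
    exact inner_self_eq_zero.1 (hmem.1 (hOM v hv) v (hle (Or.inr hv)))
  have hT0 : ∀ v ∈ M, T v = 0 := by
    intro v hv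
    have hz : CFC.abs T v + T v = 0 := by
      refine hext _ (isRealInvariant_orbit hT v) ?_ _ ⟨0, 1, Or.inl (by simp)⟩
      rintro x ⟨k, c, hx⟩
      have hpow : ∀ k : ℕ, (CFC.abs T ^ k) v ∈ M := by
        intro k
        induction k with
        | zero => simpa using hv
        | succ k ih =>
          rw [pow_succ', mul_apply_eq_comp]
          exact hPM _ ih
      have hu := M.smul_mem (c : ℂ) (hpow k)
      rcases hx with rfl | rfl
      · exact add_mem (hPM _ hu) (hTM _ hu)
      · exact M.smul_mem _ (sub_mem (hTM _ hu) (hPM _ hu))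
    have h : CFC.abs T (CFC.abs T v + T v) = 0 := by rw [hz, map_zero]
    rw [map_add, abs_apply_apply_of_sq_eq_zero hT, add_zero, abs_apply_abs_apply] at h
    rw [← inner_self_eq_zero (𝕜 := ℂ), ← adjoint_inner_right, h, inner_zero_right]
  have hT0' : ∀ v ∈ M, adjoint T v = 0 := by
    intro v hv
    rw [← inner_self_eq_zero (𝕜 := ℂ), adjoint_inner_left, hT0 _ (hTM' v hv), inner_zero_right]
  have hwM : w ∈ M := hmem.2 hw
  refine hext {w, 0} ⟨?_, ?_, ?_⟩ ?_ w (by simp)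
  · rintro x (rfl | rfl) y (rfl | rfl) <;> simp [← Complex.ofReal_pow]
  · rintro x (rfl | rfl) <;> simp [hT0 _ hwM, hT0' _ hwM]
  · rintro x (rfl | rfl) <;> simp [hT0 _ hwM, hT0' _ hwM]
  · rintro x (rfl | rfl)
    · exact hwM
    · exact M.zero_mem

/-- An operator with square zero is complex symmetric. -/
theorem complex_symmetric_of_sq_eq_zero {T : H →L[ℂ] H} (hT : ∀ x, T (T x) = 0) :
    ∃ C : H →SL[starRingEnd ℂ] H, (∀ x, C (C x) = x) ∧ (∀ x, ‖C x‖ = ‖x‖) ∧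
      (∀ x, T x = C (adjoint T (C x))) := by
  obtain ⟨S, hS⟩ := exists_maximal_isRealInvariant T
  set R := realInnerCompl (realInnerCompl S : Set H)
  have hSR : ∀ x ∈ S, x ∈ R := fun x hx s hs => inner_im_eq_zero_symm (hs x hx)
  have hinv : IsRealInvariant T (R : Set H) := hS.prop.bicompl
  obtain ⟨C, hCC, hnorm, hfix, hdec⟩ := exists_conjugation_of_real_form R
    (isClosed_realInnerCompl _) hinv.inner_im
    (fun w hw => eq_zero_of_inner_maximal_eq_zero hT hS fun s hs => hw s (hSR s hs))
  refine ⟨C, hCC, hnorm, ?_⟩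
  have hR : ∀ s ∈ R, C (adjoint T s) = T s := by
    intro s hs
    have h1 := hfix _ (hinv.add_mem s hs)
    have h2 := hfix _ (hinv.sub_mem s hs)
    rw [map_add] at h1
    rw [map_smulₛₗ, map_sub, Complex.conj_I, neg_smul, ← smul_neg] at h2
    have h3 := smul_right_injective H Complex.I_ne_zero h2
    have h4 : (2 : ℂ) • C (adjoint T s) = (2 : ℂ) • T s := by
      rw [two_smul, two_smul]
      calc C (adjoint T s) + C (adjoint T s)
          = (C (T s) + C (adjoint T s)) + -(C (T s) - C (adjoint T s)) := by abel
        _ = (T s + adjoint T s) + (T s - adjoint T s) := by rw [h1, h3]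
        _ = T s + T s := by abel
    exact smul_right_injective H two_ne_zero h4
  intro x
  obtain ⟨s, hs, t, ht, rfl⟩ := hdec x
  simp only [map_add, map_smulₛₗ, hfix s hs, hfix t ht, hR s hs, hR t ht]
  simp

/-- If a positive operator has vanishing quadratic form at `y`, it annihilates `y`. -/
theorem ContinuousLinearMap.IsPositive.apply_eq_zero {S : H →L[ℂ] H} (hS : S.IsPositive) {y : H}
    (h : inner ℂ y (S y) = 0) : S y = 0 := by
  have hpos : 0 ≤ S := (nonneg_iff_isPositive S).2 hS
  have habs : CFC.abs (CFC.sqrt S) (CFC.sqrt S y) = S y := by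
    rw [CFC.abs_of_nonneg _ (CFC.sqrt_nonneg S)]
    exact DFunLike.congr_fun (CFC.sqrt_mul_sqrt_self S hpos) y
  have h0 : CFC.sqrt S y = 0 := by
    rw [← inner_self_eq_zero (𝕜 := ℂ)]
    have h1 := inner_abs_apply (CFC.sqrt S) y (CFC.sqrt S y)
    rw [habs, h, CFC.abs_of_nonneg _ (CFC.sqrt_nonneg S)] at h1
    exact h1
  rw [← habs, h0, map_zero]

/-- A square-zero operator `A` for which some `c (A ± A*)` with `c ≠ 0` is positive vanishes. -/
theorem eq_zero_of_isPositive_of_sq_eq_zero {A : H →L[ℂ] H} (hA : ∀ x, A (A x) = 0) {c d : ℂ}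
    (hc : c ≠ 0) (hd : d ≠ 0) (hpos : (c • (A + d • adjoint A)).IsPositive) (x : H) : A x = 0 := by
  have h : (c • (A + d • adjoint A)) (A x) = 0 := by
    apply hpos.apply_eq_zero
    simp [hA, adjoint_inner_right]
  have h' : adjoint A (A x) = 0 := by
    simpa [hA, hc, hd] using h
  rw [← inner_self_eq_zero (𝕜 := ℂ), ← adjoint_inner_right, h', inner_zero_right]

end SquareZero

theorem complex_symmetric_of_cube_eq_zero
    {H : Type*} [NormedAddCommGroup H] [InnerProductSpace ℂ H] [CompleteSpace H]
    (T : H →L[ℂ] H) (h3 : T ^ 3 = 0)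
    (hpos : (((2 : ℂ)⁻¹) • (T ^ 2 + adjoint (T ^ 2))).IsPositive ∨
      (((2 * Complex.I)⁻¹) • (T ^ 2 - adjoint (T ^ 2))).IsPositive) :
    ∃ C : H →SL[starRingEnd ℂ] H,
      (∀ x, C (C x) = x) ∧ (∀ x, ‖C x‖ = ‖x‖) ∧
      (∀ x, T x = C (adjoint T (C x))) := by
  have hA : ∀ x, (T ^ 2) ((T ^ 2) x) = 0 := by
    intro x
    rw [← mul_apply_eq_comp, ← pow_add, pow_succ, h3, zero_mul, zero_apply]
  have hsq : ∀ x, (T ^ 2) x = 0 := by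
    rcases hpos with h | h
    · exact eq_zero_of_isPositive_of_sq_eq_zero hA (c := 2⁻¹) (d := 1) (by simp) one_ne_zero
        (by simpa using h)
    · exact eq_zero_of_isPositive_of_sq_eq_zero hA (c := (2 * Complex.I)⁻¹) (d := -1) (by simp)
        (by simp) (by simpa only [neg_smul, one_smul, ← sub_eq_add_neg] using h)
  refine complex_symmetric_of_sq_eq_zero fun x => ?_
  rw [← hsq x, pow_two, mul_apply_eq_comp]
end

section
/- Let H be a complex Hilbert space and let A, B be self-adjoint bounded linear operators on H with A positive. If AB + BA = 0, then AB = BA = 0. -/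
open ContinuousLinearMap

theorem mul_eq_zero_of_anticommute_pos
    {H : Type*} [NormedAddCommGroup H] [InnerProductSpace ℂ H] [CompleteSpace H]
    (A B : H →L[ℂ] H) (hA : IsSelfAdjoint A) (hB : IsSelfAdjoint B)
    (hApos : A.IsPositive) (h : A * B + B * A = 0) :
    A * B = 0 ∧ B * A = 0 := by
  have hAB : A * B = -(B * A) := eq_neg_of_add_eq_zero_left h
  have hsq : Commute (A * A) B := by
    change A * A * B = B * (A * A)
    rw [mul_assoc, hAB, mul_neg, ← mul_assoc, hAB, neg_mul, neg_neg, mul_assoc]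
  have hA0 : 0 ≤ A := (nonneg_iff_isPositive A).2 hApos
  have hcomm : Commute A B := by
    have hsqrt : Commute (CFC.sqrt (A * A)) B := hsq.cfcₙ_nnreal NNReal.sqrt
    rwa [CFC.sqrt_mul_self A hA0] at hsqrt
  have hBA : B * A = 0 := by
    rw [hcomm.eq] at h
    rw [← two_smul ℂ] at h
    exact (smul_eq_zero.mp h).resolve_left two_ne_zero
  exact ⟨hcomm.eq.trans hBA, hBA⟩
end

section
/- Let H be a complex Hilbert space and let T be a bounded linear operator on H such that T² is self-adjoint. Then T is binormal, i.e., T*T and TT* commute: (T*T)(TT*) = (TT*)(T*T). -/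
open ContinuousLinearMap

theorem binormal_of_sq_selfAdjoint
    {H : Type*} [NormedAddCommGroup H] [InnerProductSpace ℂ H] [CompleteSpace H]
    (T : H →L[ℂ] H) (h2 : IsSelfAdjoint (T ^ 2)) :
    (adjoint T * T) * (T * adjoint T) = (T * adjoint T) * (adjoint T * T) := by
  have hsq : adjoint T * adjoint T = T * T := by
    simpa only [sq, star_mul, star_eq_adjoint] using h2.star_eq
  calc (adjoint T * T) * (T * adjoint T)
      = adjoint T * (T * T) * adjoint T := by simp only [mul_assoc]
    _ = (adjoint T * adjoint T) * (adjoint T * adjoint T) := by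
      rw [← hsq]; simp only [mul_assoc]
    _ = T * (T * T) * T := by rw [hsq]; simp only [mul_assoc]
    _ = (T * adjoint T) * (adjoint T * T) := by
      rw [← hsq]; simp only [mul_assoc]
end

section
/- Let H be a complex Hilbert space and let T = A + iB be a bounded linear operator on H with A, B self-adjoint (the Cartesian decomposition). If T³ = 0, then (AB + BA)(A² − B²) = −(A² − B²)(AB + BA) and (A² − B²)² = (AB + BA)². -/
open ContinuousLinearMap

/-- The square of `a + i b` in a complex algebra, split into its two parts. -/
theorem add_I_smul_sq {R : Type*} [Ring R] [Algebra ℂ R] (a b : R) :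
    (a + Complex.I • b) ^ 2 = (a ^ 2 - b ^ 2) + Complex.I • (a * b + b * a) := by
  simp only [sq, add_mul, mul_add, smul_mul_assoc, mul_smul_comm, smul_smul, smul_add,
    Complex.I_mul_I, neg_smul, one_smul]
  abel

/-- Uniqueness of the Cartesian decomposition of zero. -/
theorem IsSelfAdjoint.eq_zero_of_add_I_smul_eq_zero {E : Type*} [AddCommGroup E] [Module ℂ E]
    [StarAddMonoid E] [StarModule ℂ E] {x y : E} (hx : IsSelfAdjoint x) (hy : IsSelfAdjoint y)
    (h : x + Complex.I • y = 0) : x = 0 ∧ y = 0 := by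
  have hstar : x - Complex.I • y = 0 := by
    simpa [hx.star_eq, hy.star_eq, sub_eq_add_neg] using congrArg star h
  have hx0 : x = 0 := by
    have h2 : (2 : ℂ) • x = 0 := by
      rw [two_smul]
      calc x + x = (x + Complex.I • y) + (x - Complex.I • y) := by abel
        _ = 0 := by rw [h, hstar, add_zero]
    exact (smul_eq_zero.mp h2).resolve_left two_ne_zero
  refine ⟨hx0, ?_⟩
  rw [hx0, zero_add] at h
  exact (smul_eq_zero.mp h).resolve_left Complex.I_ne_zero

/-- The Jordan product of self-adjoint elements is self-adjoint. -/
theorem IsSelfAdjoint.mul_add_mul_swap {R : Type*} [NonUnitalSemiring R] [StarRing R] {a b : R}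
    (ha : IsSelfAdjoint a) (hb : IsSelfAdjoint b) : IsSelfAdjoint (a * b + b * a) := by
  simp [isSelfAdjoint_iff, ha.star_eq, hb.star_eq, add_comm]

theorem anticommute_and_sq_eq_of_cube_eq_zero
    {H : Type*} [NormedAddCommGroup H] [InnerProductSpace ℂ H] [CompleteSpace H]
    (T A B : H →L[ℂ] H) (hA : IsSelfAdjoint A) (hB : IsSelfAdjoint B)
    (hT : T = A + Complex.I • B) (h3 : T ^ 3 = 0) :
    (A * B + B * A) * (A ^ 2 - B ^ 2) = -((A ^ 2 - B ^ 2) * (A * B + B * A)) ∧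
      (A ^ 2 - B ^ 2) ^ 2 = (A * B + B * A) ^ 2 := by
  have hP : IsSelfAdjoint (A ^ 2 - B ^ 2) := (hA.pow 2).sub (hB.pow 2)
  have hQ : IsSelfAdjoint (A * B + B * A) := hA.mul_add_mul_swap hB
  have h4 : (T ^ 2) ^ 2 = 0 := by
    rw [← pow_mul]
    exact pow_eq_zero_of_le (by norm_num) h3
  rw [hT, add_I_smul_sq, add_I_smul_sq] at h4
  obtain ⟨hre, him⟩ := ((hP.pow 2).sub (hQ.pow 2)).eq_zero_of_add_I_smul_eq_zero
    (hP.mul_add_mul_swap hQ) h4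
  exact ⟨eq_neg_of_add_eq_zero_right him, sub_eq_zero.mp hre⟩
end

section
/- Let H be a complex Hilbert space and let T = A + iB be a bounded linear operator on H with A, B self-adjoint (the Cartesian decomposition). If T² and T³ are self-adjoint, A ≥ 0, and AB = BA, then B³ = 0 and hence B = 0, so T is self-adjoint. -/
open ContinuousLinearMap

theorem imaginary_part_cube_zero_selfAdjoint
    {H : Type*} [NormedAddCommGroup H] [InnerProductSpace ℂ H] [CompleteSpace H]
    (T A B : H →L[ℂ] H) (hA : IsSelfAdjoint A) (hB : IsSelfAdjoint B)
    (hT : T = A + Complex.I • B)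
    (h2 : IsSelfAdjoint (T ^ 2)) (h3 : IsSelfAdjoint (T ^ 3))
    (hApos : A.IsPositive) (hcomm : A * B = B * A) :
    B ^ 3 = 0 ∧ B = 0 ∧ IsSelfAdjoint T := by
  have hTstar : star T = A - Complex.I • B := by
    simp [hT, star_add, star_smul, hA.star_eq, hB.star_eq, sub_eq_add_neg]
  have h2' : (A - Complex.I • B) ^ 2 = (A + Complex.I • B) ^ 2 := by
    rw [← hTstar, ← star_pow, h2.star_eq, hT]
  have h3' : (A - Complex.I • B) ^ 3 = (A + Complex.I • B) ^ 3 := by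
    rw [← hTstar, ← star_pow, h3.star_eq, hT]
  have hAB : A * B = 0 := by
    have h : (4 * Complex.I) • (A * B) = (A + Complex.I • B) ^ 2 - (A - Complex.I • B) ^ 2 := by
      simp only [pow_two, mul_add, add_mul, mul_sub, sub_mul, smul_mul_assoc, mul_smul_comm,
        ← hcomm]
      module
    rw [h2', sub_self] at h
    exact (smul_eq_zero.mp h).resolve_left (by simp)
  have hBA : B * A = 0 := hcomm ▸ hAB
  have hcube (c : ℂ) : (A + c • B) ^ 3 = A ^ 3 + c ^ 3 • B ^ 3 := by
    simp only [pow_succ, pow_zero, one_mul, mul_add, add_mul, smul_mul_assoc, mul_smul_comm,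
      hAB, hBA, smul_zero, add_zero, zero_add, smul_smul, mul_assoc, mul_zero]
  have hB3 : B ^ 3 = 0 := by
    have h : (2 * Complex.I) • B ^ 3 = 0 := by
      rw [sub_eq_add_neg, ← neg_smul, hcube, hcube, add_right_inj, ← sub_eq_zero, ← sub_smul] at h3'
      convert h3' using 2
      linear_combination (2 * Complex.I) * Complex.I_sq
    exact (smul_eq_zero.mp h).resolve_left (by simp)
  have hBsq : B * B = 0 := by
    rw [← CStarRing.star_mul_self_eq_zero_iff, star_mul, hB.star_eq]
    calc B * B * (B * B) = B ^ 3 * B := by noncomm_ring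
      _ = 0 := by rw [hB3, zero_mul]
  have hB0 : B = 0 := by
    rw [← CStarRing.star_mul_self_eq_zero_iff, hB.star_eq, hBsq]
  refine ⟨hB3, hB0, ?_⟩
  rwa [hT, hB0, smul_zero, add_zero]
end
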